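/- For every a > 0 and every x > 0, the quantity h(x) admits the representation h(x) = 4·(∫_{−x}^{ax} u³·φ(u) du)·(∫_{−x}^{ax} φ(u) du) − 4·(∫_{−x}^{ax} u·φ(u) du)·(∫_{−x}^{ax} u²·φ(u) du). -/

import Mathlib

open MeasureTheory intervalIntegral

/-- `φ(x) = exp(-x²)`. -/
noncomputable def phi (x : ℝ) : ℝ := Real.exp (-x ^ 2)

/-- `Φ(x) = ∫₀ˣ φ(u) du`. -/
noncomputable def Phi (x : ℝ) : ℝ := ∫ u in (0 : ℝ)..x, phi u

/-- `φ'(x) = -2x·exp(-x²)`, the derivative of `φ`. -/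
noncomputable def phi' (x : ℝ) : ℝ := -2 * x * Real.exp (-x ^ 2)

/-- `f(x) = (φ(ax) - φ(x)) / (x·(Φ(ax) + Φ(x)))`. -/
noncomputable def f (a x : ℝ) : ℝ :=
  (phi (a * x) - phi x) / (x * (Phi (a * x) + Phi x))

/-- `h(x) = (axφ'(ax) - xφ'(x))(Φ(ax)+Φ(x)) - (φ(ax)-φ(x))(Φ(ax)+Φ(x))
      - (φ(ax)-φ(x))(axφ(ax)+xφ(x))`. -/
noncomputable def h (a x : ℝ) : ℝ :=
  (a * x * phi' (a * x) - x * phi' x) * (Phi (a * x) + Phi x)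
    - (phi (a * x) - phi x) * (Phi (a * x) + Phi x)
    - (phi (a * x) - phi x) * (a * x * phi (a * x) + x * phi x)

theorem continuous_phi : Continuous phi := by
  unfold phi
  fun_prop

theorem phi_neg (x : ℝ) : phi (-x) = phi x := by
  simp [phi]

theorem hasDerivAt_phi (u : ℝ) : HasDerivAt phi (-2 * u * phi u) u := by
  unfold phi
  exact (hasDerivAt_pow 2 u).fun_neg.exp.congr_deriv (by push_cast; ring)

theorem integral_phi (s t : ℝ) : ∫ u in s..t, phi u = Phi t - Phi s := by
  unfold Phi
  exact (integral_interval_sub_left (continuous_phi.intervalIntegrable _ _)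
    (continuous_phi.intervalIntegrable _ _)).symm

theorem Phi_neg (x : ℝ) : Phi (-x) = -Phi x := by
  have key : ∫ u in (0 : ℝ)..x, phi (-u) = ∫ u in (-x)..(-0), phi u :=
    integral_comp_neg phi
  simp only [phi_neg, neg_zero] at key
  unfold Phi
  rw [key, integral_symm]

theorem integral_id_mul_phi (s t : ℝ) :
    ∫ u in s..t, u * phi u = -(phi t - phi s) / 2 := by
  have hc := continuous_phi
  rw [integral_eq_sub_of_hasDerivAt (f := fun u => -(1 / 2) * phi u)
    (f' := fun u => u * phi u)
    (fun u _ => ((hasDerivAt_phi u).const_mul (-(1 / 2))).congr_deriv (by ring))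
    (Continuous.intervalIntegrable (by fun_prop) _ _)]
  ring

theorem integral_sq_mul_phi (s t : ℝ) :
    ∫ u in s..t, u ^ 2 * phi u = (Phi t - Phi s - (t * phi t - s * phi s)) / 2 := by
  have hc := continuous_phi
  have hPhi (u : ℝ) : HasDerivAt Phi (phi u) u := hc.integral_hasStrictDerivAt 0 u |>.hasDerivAt
  rw [integral_eq_sub_of_hasDerivAt (f := fun u => (1 / 2) * (Phi u - u * phi u))
    (f' := fun u => u ^ 2 * phi u)
    (fun u _ => (((hPhi u).sub ((hasDerivAt_id' u).mul (hasDerivAt_phi u))).const_mul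
      (1 / 2)).congr_deriv (by ring))
    (Continuous.intervalIntegrable (by fun_prop) _ _)]
  ring

theorem integral_cube_mul_phi (s t : ℝ) :
    ∫ u in s..t, u ^ 3 * phi u = -((t ^ 2 + 1) * phi t - (s ^ 2 + 1) * phi s) / 2 := by
  have hc := continuous_phi
  rw [integral_eq_sub_of_hasDerivAt (f := fun u => -(1 / 2) * ((u ^ 2 + 1) * phi u))
    (f' := fun u => u ^ 3 * phi u)
    (fun u _ => ((((hasDerivAt_pow 2 u).add_const 1).mul (hasDerivAt_phi u)).const_mul
      (-(1 / 2))).congr_deriv (by push_cast; ring))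
    (Continuous.intervalIntegrable (by fun_prop) _ _)]
  ring

theorem phi'_eq (x : ℝ) : phi' x = -2 * x * phi x := rfl

theorem statement_8 (a x : ℝ) (ha : 0 < a) (hx : 0 < x) :
    h a x =
      4 * (∫ u in (-x)..(a * x), u ^ 3 * phi u) * (∫ u in (-x)..(a * x), phi u)
        - 4 * (∫ u in (-x)..(a * x), u * phi u)
            * (∫ u in (-x)..(a * x), u ^ 2 * phi u) := by
  rw [integral_cube_mul_phi, integral_phi, integral_id_mul_phi, integral_sq_mul_phi]
  simp only [h, phi'_eq, phi_neg, Phi_neg]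
  ring
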